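/- arXiv:2305.00661 — 2 statements merged into one kernel-verified Lean document; each statement's English description precedes it below -/
import Mathlib

section
/- Existence for the nonlocal difference equation (Lemma 3.1). Let n ≥ 1, let Ω ⊂ ℝⁿ be a bounded domain, s ∈ (0,1), p > 1, q > 0, h > 0, and let v ∈ X = W^{s,p}_0(Ω) ∩ L^{q+1}(Ω). Then there exists u ∈ X such that for every ξ ∈ X, (1/h)∫_Ω (|u|^{q−1}u − |v|^{q−1}v) ξ dx + (1/2)∬_{ℝⁿ×ℝⁿ} |u(x)−u(y)|^{p−2}(u(x)−u(y))(ξ(x)−ξ(y)) / |x−y|^{n+sp} dx dy = 0. -/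
open MeasureTheory ENNReal Real Filter Set

noncomputable section

/-- `ℝⁿ` with the Euclidean structure. -/
abbrev Rn (n : ℕ) : Type := EuclideanSpace ℝ (Fin n)

/-- A bounded domain in `ℝⁿ`: a nonempty connected open bounded set. -/
def IsBoundedDomain {n : ℕ} (Ω : Set (Rn n)) : Prop :=
  IsOpen Ω ∧ IsConnected Ω ∧ Bornology.IsBounded Ω

/-- The Gagliardo `W^{s,p}` energy `∬ |v x − v y|^p / |x−y|^{n+sp} dx dy`,
as an extended real number. -/
def gagliardoE (n : ℕ) (s p : ℝ) (v : Rn n → ℝ) : ℝ≥0∞ :=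
  ∫⁻ x : Rn n, ∫⁻ y : Rn n, ENNReal.ofReal (|v x - v y| ^ p / dist x y ^ ((n : ℝ) + s * p))

/-- The Gagliardo seminorm `[v]_{W^{s,p}(ℝⁿ)}` as a real number
(meaningful when the Gagliardo energy is finite). -/
def gagliardoSemi (n : ℕ) (s p : ℝ) (v : Rn n → ℝ) : ℝ :=
  (gagliardoE n s p v).toReal ^ (1 / p)

/-- The class `X = W^{s,p}_0(Ω) ∩ L^{q+1}(Ω)`: measurable functions vanishing a.e.
outside `Ω`, belonging to `L^p(ℝⁿ)`, with finite Gagliardo energy and finite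
`L^{q+1}(Ω)` norm. -/
def MemX (n : ℕ) (Ω : Set (Rn n)) (s p q : ℝ) (u : Rn n → ℝ) : Prop :=
  Measurable u ∧ (∀ᵐ x : Rn n, x ∉ Ω → u x = 0) ∧
    (∫⁻ x : Rn n, ENNReal.ofReal (|u x| ^ p)) < ⊤ ∧
    gagliardoE n s p u < ⊤ ∧
    (∫⁻ x in Ω, ENNReal.ofReal (|u x| ^ (q + 1))) < ⊤

/-- `u` solves the discrete (Rothe-type) nonlocal equation with datum `v` and time step `h`:
for every test function `ξ ∈ X`,
`(1/h)∫_Ω (|u|^{q−1}u − |v|^{q−1}v) ξ dx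
  + (1/2)∬ |u(x)−u(y)|^{p−2}(u(x)−u(y))(ξ(x)−ξ(y))/|x−y|^{n+sp} dx dy = 0`. -/
def SolvesDiscrete (n : ℕ) (Ω : Set (Rn n)) (s p q h : ℝ) (u v : Rn n → ℝ) : Prop :=
  ∀ ξ : Rn n → ℝ, MemX n Ω s p q ξ →
    (1 / h) * (∫ x in Ω, (|u x| ^ (q - 1) * u x - |v x| ^ (q - 1) * v x) * ξ x) +
      (1 / 2) * (∫ x : Rn n, ∫ y : Rn n,
        (|u x - u y| ^ (p - 2) * (u x - u y)) * (ξ x - ξ y) / dist x y ^ ((n : ℝ) + s * p)) = 0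

/-! ### The function `t ↦ |t| ^ r` on the real line -/

lemma abs_abs_rpow_sub_mul_self {r : ℝ} (hr : r ≠ 1) (a : ℝ) :
    |(|a| ^ (r - 2) * a)| = |a| ^ (r - 1) := by
  rcases eq_or_ne a 0 with rfl | ha
  · simp [Real.zero_rpow (sub_ne_zero.2 hr)]
  · rw [abs_mul, abs_of_nonneg (by positivity), ← Real.rpow_add_one (abs_ne_zero.2 ha)]
    ring_nf

lemma two_mul_abs_midpoint_rpow_lt {r : ℝ} (hr : 1 < r) {a b : ℝ} (hab : a ≠ b) :
    2 * |(a + b) / 2| ^ r < |a| ^ r + |b| ^ r := by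
  by_cases h : |a| = |b|
  · have hba : a = -b := (abs_eq_abs.1 h).resolve_left hab
    have hb : b ≠ 0 := by rintro rfl; exact hab (by simpa using hba)
    have : 0 < |b| ^ r := Real.rpow_pos_of_pos (abs_pos.2 hb) _
    rw [hba, neg_add_cancel, zero_div, abs_zero, Real.zero_rpow (by linarith), abs_neg]
    linarith
  · have h1 := (strictConvexOn_rpow hr).2 (abs_nonneg a) (abs_nonneg b) h
      (by norm_num : (0 : ℝ) < 1 / 2) (by norm_num : (0 : ℝ) < 1 / 2) (by norm_num)
    have h2 : |(a + b) / 2| ^ r ≤ ((1 / 2 : ℝ) • |a| + (1 / 2 : ℝ) • |b|) ^ r := by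
      refine Real.rpow_le_rpow (abs_nonneg _) ?_ (by linarith)
      rw [abs_div, abs_two, smul_eq_mul, smul_eq_mul]
      linarith [abs_add_le a b]
    simp only [smul_eq_mul] at h1 h2
    linarith

lemma two_mul_abs_midpoint_rpow_le {r : ℝ} (hr : 1 < r) (a b : ℝ) :
    2 * |(a + b) / 2| ^ r ≤ |a| ^ r + |b| ^ r := by
  rcases eq_or_ne a b with rfl | hab
  · rw [add_self_div_two]; linarith
  · exact (two_mul_abs_midpoint_rpow_lt hr hab).le

/-- Quantitative uniform convexity of `t ↦ |t| ^ r`. -/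
lemma exists_abs_sub_rpow_le {r : ℝ} (hr : 1 < r) {ε : ℝ} (hε : 0 < ε) :
    ∃ C : ℝ, 0 ≤ C ∧ ∀ a b : ℝ, |a - b| ^ r ≤
      ε * (|a| ^ r + |b| ^ r) + C * (|a| ^ r + |b| ^ r - 2 * |(a + b) / 2| ^ r) := by
  have hr0 : 0 ≤ r := by linarith
  have hc : ∀ g : ℝ × ℝ → ℝ, Continuous g → Continuous fun z => |g z| ^ r :=
    fun g hg => hg.abs.rpow_const fun _ => Or.inr hr0
  have c1 := hc (fun z => z.1) (by fun_prop)
  have c2 := hc (fun z => z.2) (by fun_prop)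
  have c3 := hc (fun z => z.1 - z.2) (by fun_prop)
  have c4 := hc (fun z => (z.1 + z.2) / 2) (by fun_prop)
  set K : Set (ℝ × ℝ) := Metric.sphere 0 1 ∩
    {z | ε * (|z.1| ^ r + |z.2| ^ r) ≤ |z.1 - z.2| ^ r}
  have hKc : IsCompact K :=
    (isCompact_sphere _ _).inter_right (isClosed_le (by fun_prop) c3)
  obtain ⟨δ, hδ, hδK⟩ := hKc.exists_forall_le'
    (f := fun z => |z.1| ^ r + |z.2| ^ r - 2 * |(z.1 + z.2) / 2| ^ r)
    (Continuous.continuousOn (by fun_prop)) (a := 0) (by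
      rintro ⟨a, b⟩ ⟨hz1, hz2⟩
      refine sub_pos.2 (two_mul_abs_midpoint_rpow_lt hr ?_)
      intro hab
      obtain rfl : a = b := hab
      have ha : a ≠ 0 := by
        rintro rfl
        simp at hz1
      have := Real.rpow_pos_of_pos (abs_pos.2 ha) r
      simp only [mem_ofPred_eq, sub_self, abs_zero, Real.zero_rpow (by linarith : r ≠ 0)] at hz2
      nlinarith)
  refine ⟨2 ^ r / δ, by positivity, fun a b => ?_⟩
  have hsphere : ∀ z : ℝ × ℝ, z ∈ Metric.sphere (0 : ℝ × ℝ) 1 → |z.1 - z.2| ^ r ≤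
      ε * (|z.1| ^ r + |z.2| ^ r) +
        2 ^ r / δ * (|z.1| ^ r + |z.2| ^ r - 2 * |(z.1 + z.2) / 2| ^ r) := by
    intro z hz
    have hdef := sub_nonneg.2 (two_mul_abs_midpoint_rpow_le hr z.1 z.2)
    by_cases hzK : ε * (|z.1| ^ r + |z.2| ^ r) ≤ |z.1 - z.2| ^ r
    · have h1 := hδK z ⟨hz, hzK⟩
      have h2 : |z.1 - z.2| ^ r ≤ 2 ^ r := by
        refine Real.rpow_le_rpow (abs_nonneg _) ?_ hr0
        have hn : ‖z‖ = 1 := by simpa using hz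
        have := norm_fst_le z
        have := norm_snd_le z
        simp only [Real.norm_eq_abs] at *
        linarith [abs_sub z.1 z.2]
      have h3 : 2 ^ r ≤ 2 ^ r / δ * (|z.1| ^ r + |z.2| ^ r - 2 * |(z.1 + z.2) / 2| ^ r) := by
        rw [div_mul_eq_mul_div, le_div_iff₀ hδ]
        gcongr
      have h4 : 0 ≤ ε * (|z.1| ^ r + |z.2| ^ r) := by positivity
      linarith
    · have : 0 ≤ 2 ^ r / δ * (|z.1| ^ r + |z.2| ^ r - 2 * |(z.1 + z.2) / 2| ^ r) := by
        positivity
      linarith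
  by_cases h0 : ((a, b) : ℝ × ℝ) = 0
  · obtain ⟨rfl, rfl⟩ : a = 0 ∧ b = 0 := by simpa using h0
    simp [Real.zero_rpow (by linarith : r ≠ 0)]
  · set N := ‖((a, b) : ℝ × ℝ)‖ with hN
    have hNpos : 0 < N := norm_pos_iff.2 h0
    have key := hsphere (N⁻¹ • (a, b)) (by
      rw [mem_sphere_zero_iff_norm, norm_smul, norm_inv, norm_norm, ← hN]
      field_simp)
    simp only [Prod.smul_mk, smul_eq_mul] at key
    have hm : ∀ t : ℝ, |N⁻¹ * t| ^ r = (N ^ r)⁻¹ * |t| ^ r := by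
      intro t
      rw [abs_mul, abs_of_pos (inv_pos.2 hNpos), Real.mul_rpow (by positivity) (abs_nonneg _),
        Real.inv_rpow hNpos.le]
    rw [← mul_sub, ← mul_add, mul_div_assoc, hm, hm, hm, hm] at key
    have hNr : 0 < N ^ r := Real.rpow_pos_of_pos hNpos _
    have := mul_le_mul_of_nonneg_left key hNr.le
    field_simp at this ⊢
    linarith

/-- Young's inequality with a small weight on the second factor. -/
lemma exists_abs_rpow_mul_abs_le {q : ℝ} (hq : 0 < q) {ε : ℝ} (hε : 0 < ε) :
    ∃ C : ℝ, ∀ a b : ℝ,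
      |b| ^ q * |a| ≤ ε * |a| ^ (q + 1) + C * |b| ^ (q + 1) := by
  set δ := ε ^ (1 / q) with hδ
  have hδ0 : 0 < δ := by positivity
  have hδq : δ ^ q = ε := by
    rw [hδ, ← Real.rpow_mul hε.le, one_div_mul_cancel hq.ne', Real.rpow_one]
  have hsplit : ∀ t : ℝ, |t| ^ (q + 1) = |t| ^ q * |t| := fun t =>
    Real.rpow_add_one' (abs_nonneg t) (by linarith)
  refine ⟨δ⁻¹, fun a b => ?_⟩
  rw [hsplit, hsplit]
  rcases le_total |b| (δ * |a|) with h | h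
  · have h1 : |b| ^ q ≤ ε * |a| ^ q := by
      rw [← hδq, ← Real.mul_rpow hδ0.le (abs_nonneg a)]
      exact Real.rpow_le_rpow (abs_nonneg _) h hq.le
    have h2 := mul_le_mul_of_nonneg_right h1 (abs_nonneg a)
    have : 0 ≤ δ⁻¹ * (|b| ^ q * |b|) := by positivity
    linarith
  · have h1 : |a| ≤ δ⁻¹ * |b| := by
      rw [inv_mul_eq_div, le_div_iff₀ hδ0]; linarith
    have h2 := mul_le_mul_of_nonneg_left h1 (by positivity : 0 ≤ |b| ^ q)
    have : 0 ≤ ε * (|a| ^ q * |a|) := by positivity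
    linarith

/-! ### Integrals of `|f| ^ r` -/

section Lr

variable {α : Type*} [MeasurableSpace α] {μ : Measure α}

lemma lintegral_ofReal_abs_rpow_eq {r : ℝ} (hr : 0 < r) (f : α → ℝ) :
    ∫⁻ x, ENNReal.ofReal (|f x| ^ r) ∂μ = ∫⁻ x, ‖f x‖ₑ ^ (ENNReal.ofReal r).toReal ∂μ := by
  refine lintegral_congr fun x => ?_
  rw [ENNReal.toReal_ofReal hr.le, ← ENNReal.ofReal_rpow_of_nonneg (abs_nonneg _) hr.le,
    Real.enorm_eq_ofReal_abs]

lemma memLp_iff_lintegral_ofReal_abs_rpow_lt_top {r : ℝ} (hr : 0 < r) {f : α → ℝ}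
    (hf : Measurable f) :
    MemLp f (ENNReal.ofReal r) μ ↔ ∫⁻ x, ENNReal.ofReal (|f x| ^ r) ∂μ < ⊤ := by
  rw [lintegral_ofReal_abs_rpow_eq hr, ← eLpNorm_lt_top_iff_lintegral_rpow_enorm_lt_top
    (by simpa using hr) ENNReal.ofReal_ne_top]
  exact ⟨fun h => h.2, fun h => ⟨hf.aestronglyMeasurable, h⟩⟩

lemma MeasureTheory.MemLp.integrable_abs_rpow {r : ℝ} (hr : 0 < r) {f : α → ℝ}
    (hf : MemLp f (ENNReal.ofReal r) μ) : Integrable (fun x => |f x| ^ r) μ := by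
  simpa [ENNReal.toReal_ofReal hr.le] using
    hf.integrable_norm_rpow (by simpa using hr) ENNReal.ofReal_ne_top

/-- A sequence which is Cauchy in `L^r` has an almost everywhere convergent subsequence. -/
lemma exists_subseq_ae_tendsto_of_cauchy {r : ℝ} (hr : 1 ≤ r) {f : ℕ → α → ℝ}
    (hf : ∀ k, Measurable (f k))
    (hC : ∀ ε : ℝ≥0∞, 0 < ε → ∃ N, ∀ i ≥ N, ∀ j ≥ N,
      ∫⁻ x, ENNReal.ofReal (|f i x - f j x| ^ r) ∂μ < ε) :
    ∃ φ : ℕ → ℕ, StrictMono φ ∧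
      ∀ᵐ x ∂μ, ∃ l, Tendsto (fun k => f (φ k) x) atTop (nhds l) := by
  have hr0 : 0 < r := by linarith
  obtain ⟨B, hB0, hBsum⟩ := ENNReal.exists_pos_sum_of_countable' (one_ne_zero (α := ℝ≥0∞)) ℕ
  obtain ⟨φ, hφ, hφB⟩ := Filter.extraction_forall_of_eventually'
    (P := fun N k => ∀ i ≥ k, ∀ j ≥ k, ∫⁻ x, ENNReal.ofReal (|f i x - f j x| ^ r) ∂μ < B N ^ r)
    (by
      intro N
      obtain ⟨M, hM⟩ := hC (B N ^ r) (ENNReal.rpow_pos (hB0 N)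
        (ne_top_of_le_ne_top (hBsum.trans one_lt_top).ne (ENNReal.le_tsum N)))
      exact ⟨M, fun k hk i hi j hj => hM i (hk.trans hi) j (hk.trans hj)⟩)
  refine ⟨φ, hφ, Lp.ae_tendsto_of_cauchy_eLpNorm (p := ENNReal.ofReal r) (B := B)
    (fun k => (hf (φ k)).aestronglyMeasurable) (by simpa using hr)
    (hBsum.trans one_lt_top).ne ?_⟩
  intro N i j hi hj
  have h := hφB N (φ i) (hφ.monotone hi) (φ j) (hφ.monotone hj)
  rw [eLpNorm_eq_lintegral_rpow_enorm_toReal (by simpa using hr0) ENNReal.ofReal_ne_top,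
    ← lintegral_ofReal_abs_rpow_eq hr0, ENNReal.toReal_ofReal hr0.le]
  calc _ < (B N ^ r) ^ (1 / r) := ENNReal.rpow_lt_rpow h (by positivity)
    _ = B N := by rw [← ENNReal.rpow_mul, mul_one_div_cancel hr0.ne', ENNReal.rpow_one]

/-- The `r`-th power of the `L^r` norm is differentiable along lines. -/
lemma hasDerivAt_integral_abs_add_mul_rpow {r : ℝ} (hr : 1 < r) {f g : α → ℝ}
    (hf : Measurable f) (hg : Measurable g)
    (hfL : MemLp f (ENNReal.ofReal r) μ) (hgL : MemLp g (ENNReal.ofReal r) μ) :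
    Integrable (fun x => |f x| ^ (r - 2) * f x * g x) μ ∧
      HasDerivAt (fun t : ℝ => ∫ x, |f x + t * g x| ^ r ∂μ)
        (r * ∫ x, |f x| ^ (r - 2) * f x * g x ∂μ) 0 := by
  have hr0 : 0 < r := by linarith
  have hbound : Integrable (fun x => r * (|f x| + |g x|) ^ r) μ := by
    have h := (hfL.abs.add hgL.abs).integrable_abs_rpow hr0
    refine (h.const_mul r).congr (Eventually.of_forall fun x => ?_)
    simp only [Pi.add_apply, Pi.abs_apply]
    rw [abs_of_nonneg (a := |f x| + |g x|) (by positivity)]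
  have key := hasDerivAt_integral_of_dominated_loc_of_deriv_le (μ := μ) (𝕜 := ℝ)
    (F := fun t x => |f x + t * g x| ^ r)
    (F' := fun t x => r * |f x + t * g x| ^ (r - 2) * (f x + t * g x) * g x)
    (x₀ := 0) (Metric.ball_mem_nhds (0 : ℝ) one_pos)
    (Eventually.of_forall fun t => (Measurable.aestronglyMeasurable (by fun_prop)))
    (by simpa using hfL.integrable_abs_rpow hr0)
    (Measurable.aestronglyMeasurable (by fun_prop))
    (Eventually.of_forall fun x t ht => ?_) hbound
    (Eventually.of_forall fun x t _ => ?_)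
  · simp only [zero_mul, add_zero, mul_assoc, integral_const_mul] at key
    refine ⟨?_, by simpa only [mul_assoc] using key.2⟩
    simpa [hr0.ne', mul_assoc] using key.1.const_mul r⁻¹
  · rw [mem_ball_zero_iff, Real.norm_eq_abs] at ht
    rw [Real.norm_eq_abs, mul_assoc r, mul_assoc r, abs_mul, abs_of_pos hr0, abs_mul,
      abs_abs_rpow_sub_mul_self hr.ne']
    have h1 : |f x + t * g x| ≤ |f x| + |g x| := by
      have := abs_add_le (f x) (t * g x)
      rw [abs_mul] at this
      nlinarith [abs_nonneg (g x)]
    have h2 : (|f x| + |g x|) ^ r = (|f x| + |g x|) ^ (r - 1) * (|f x| + |g x|) := by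
      rw [← Real.rpow_add_one' (by positivity) (by simpa using hr0.ne'), sub_add_cancel]
    rw [h2]
    gcongr
    linarith [abs_nonneg (f x)]
  · have h1 : HasDerivAt (fun t : ℝ => f x + t * g x) (g x) t := by
      simpa using ((hasDerivAt_id t).mul_const (g x)).const_add (f x)
    exact (hasDerivAt_abs_rpow (f x + t * g x) hr).comp t h1

end Lr

/-! ### The class `X` in terms of `L^r` spaces -/

/-- The weighted difference `(u x - u y) / |x - y| ^ ((n + s p) / p)`, whose `L^p` norm is the
Gagliardo seminorm. -/
def weightedDiff (n : ℕ) (s p : ℝ) (u : Rn n → ℝ) (z : Rn n × Rn n) : ℝ :=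
  (u z.1 - u z.2) / dist z.1 z.2 ^ (((n : ℝ) + s * p) / p)

section WeightedDiff

variable {n : ℕ} {s p : ℝ}

lemma measurable_weightedDiff {u : Rn n → ℝ} (hu : Measurable u) :
    Measurable (weightedDiff n s p u) := by
  unfold weightedDiff
  fun_prop

lemma weightedDiff_add_mul (u ξ : Rn n → ℝ) (t : ℝ) (z : Rn n × Rn n) :
    weightedDiff n s p (fun x => u x + t * ξ x) z =
      weightedDiff n s p u z + t * weightedDiff n s p ξ z := by
  unfold weightedDiff
  ring

lemma weightedDiff_midpoint (u w : Rn n → ℝ) (z : Rn n × Rn n) :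
    weightedDiff n s p (fun x => (u x + w x) / 2) z =
      (weightedDiff n s p u z + weightedDiff n s p w z) / 2 := by
  unfold weightedDiff
  ring

lemma abs_weightedDiff_rpow (hp : 0 < p) (u : Rn n → ℝ) (z : Rn n × Rn n) :
    |weightedDiff n s p u z| ^ p =
      |u z.1 - u z.2| ^ p / dist z.1 z.2 ^ ((n : ℝ) + s * p) := by
  rw [weightedDiff, abs_div, abs_of_nonneg (a := dist z.1 z.2 ^ _) (by positivity),
    Real.div_rpow (abs_nonneg _) (by positivity), ← Real.rpow_mul dist_nonneg,
    div_mul_cancel₀ _ hp.ne']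

lemma abs_weightedDiff_rpow_mul (hp : 0 < p) (u ξ : Rn n → ℝ) (z : Rn n × Rn n) :
    |weightedDiff n s p u z| ^ (p - 2) * weightedDiff n s p u z * weightedDiff n s p ξ z =
      (|u z.1 - u z.2| ^ (p - 2) * (u z.1 - u z.2)) * (ξ z.1 - ξ z.2) /
        dist z.1 z.2 ^ ((n : ℝ) + s * p) := by
  rcases eq_or_ne z.1 z.2 with h | h
  · simp [weightedDiff, h]
  · have hd : 0 < dist z.1 z.2 := dist_pos.2 h
    have hw : dist z.1 z.2 ^ ((n : ℝ) + s * p) =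
        (dist z.1 z.2 ^ (((n : ℝ) + s * p) / p)) ^ (p - 2) *
          dist z.1 z.2 ^ (((n : ℝ) + s * p) / p) * dist z.1 z.2 ^ (((n : ℝ) + s * p) / p) := by
      rw [← Real.rpow_mul hd.le, ← Real.rpow_add hd, ← Real.rpow_add hd]
      congr 1
      field_simp
      ring
    have hpos : 0 < dist z.1 z.2 ^ (((n : ℝ) + s * p) / p) := by positivity
    rw [hw, weightedDiff, weightedDiff, abs_div, abs_of_pos hpos,
      Real.div_rpow (abs_nonneg _) hpos.le]
    ring

lemma gagliardoE_eq_lintegral_weightedDiff (hp : 0 < p) {u : Rn n → ℝ} (hu : Measurable u) :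
    gagliardoE n s p u = ∫⁻ z, ENNReal.ofReal (|weightedDiff n s p u z| ^ p) := by
  have hm := measurable_weightedDiff (s := s) (p := p) hu
  rw [Measure.volume_eq_prod, lintegral_prod _ (by fun_prop)]
  simp only [abs_weightedDiff_rpow hp]
  rfl

/-- A fractional Poincaré inequality, in qualitative form: a function vanishing outside a
bounded set lies in `L^p` as soon as its Gagliardo energy is finite. -/
lemma lintegral_abs_rpow_lt_top_of_gagliardoE_lt_top (hn : 1 ≤ n) (hs : 0 < s) (hp : 0 < p)
    {Ω : Set (Rn n)} (hΩ : Bornology.IsBounded Ω) {u : Rn n → ℝ}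
    (hu0 : ∀ᵐ x : Rn n, x ∉ Ω → u x = 0) (hE : gagliardoE n s p u < ⊤) :
    ∫⁻ x : Rn n, ENNReal.ofReal (|u x| ^ p) < ⊤ := by
  have : Nonempty (Fin n) := ⟨⟨0, hn⟩⟩
  obtain ⟨R, hR0, hR⟩ := hΩ.subset_ball_lt 0 0
  obtain ⟨x₀, hx₀⟩ := NormedSpace.exists_lt_norm ℝ (Rn n) (R + 1)
  set M := R + ‖x₀‖ + 1 with hM
  have hM0 : 0 < M := by positivity
  set e := (n : ℝ) + s * p with he
  have he0 : 0 < e := by positivity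
  have hfar : ∀ y ∈ Metric.ball x₀ 1, y ∉ Ω := by
    intro y hy hyΩ
    have h1 := hR hyΩ
    rw [mem_ball_zero_iff] at h1
    rw [mem_ball_iff_norm, norm_sub_rev] at hy
    linarith [norm_sub_norm_le x₀ y]
  set c : ℝ≥0∞ := volume (Metric.ball x₀ 1) * ENNReal.ofReal (M ^ e)⁻¹ with hc
  have hc0 : c ≠ 0 := mul_ne_zero (Metric.measure_ball_pos _ _ one_pos).ne'
    (ENNReal.ofReal_pos.2 (by positivity)).ne'
  have hctop : c ≠ ⊤ := ENNReal.mul_ne_top measure_ball_lt_top.ne ENNReal.ofReal_ne_top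
  have hle : c * ∫⁻ x : Rn n, ENNReal.ofReal (|u x| ^ p) ≤ gagliardoE n s p u := by
    rw [← lintegral_const_mul' _ _ hctop, gagliardoE]
    refine lintegral_mono_ae ?_
    filter_upwards [hu0] with x hx
    by_cases hxΩ : x ∈ Ω
    · have hstep : ∫⁻ _ in Metric.ball x₀ 1, ENNReal.ofReal (|u x| ^ p * (M ^ e)⁻¹) ≤
          ∫⁻ y in Metric.ball x₀ 1, ENNReal.ofReal (|u x - u y| ^ p / dist x y ^ e) := by
        refine lintegral_mono_ae ?_
        rw [ae_restrict_iff' measurableSet_ball]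
        filter_upwards [hu0] with y hy hyb
        have hyΩ := hfar y hyb
        rw [hy hyΩ, sub_zero, div_eq_mul_inv]
        have hxy : 0 < dist x y := dist_pos.2 fun h => hyΩ (h ▸ hxΩ)
        have hd : dist x y ≤ M := by
          have h1 : dist x 0 < R := hR hxΩ
          have h2 : dist y x₀ < 1 := hyb
          have h3 : dist x₀ 0 = ‖x₀‖ := dist_zero_right _
          have h4 := dist_triangle4 x 0 x₀ y
          rw [dist_comm 0 x₀, dist_comm x₀ y] at h4
          linarith
        gcongr
      calc c * ENNReal.ofReal (|u x| ^ p)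
          = ∫⁻ _ in Metric.ball x₀ 1, ENNReal.ofReal (|u x| ^ p * (M ^ e)⁻¹) := by
            rw [setLIntegral_const, hc, ENNReal.ofReal_mul (by positivity)]
            ring
        _ ≤ _ := hstep.trans (setLIntegral_le_lintegral _ _)
    · simp [hx hxΩ, Real.zero_rpow hp.ne']
  by_contra htop
  rw [not_lt, top_le_iff] at htop
  rw [htop, ENNReal.mul_top hc0, top_le_iff] at hle
  exact hE.ne hle

variable {q : ℝ} {Ω : Set (Rn n)}

lemma memX_iff_memLp (hp : 0 < p) (hq : 0 < q) {u : Rn n → ℝ} :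
    MemX n Ω s p q u ↔ Measurable u ∧ (∀ᵐ x : Rn n, x ∉ Ω → u x = 0) ∧
      MemLp u (ENNReal.ofReal p) ∧ MemLp (weightedDiff n s p u) (ENNReal.ofReal p) ∧
      MemLp u (ENNReal.ofReal (q + 1)) (volume.restrict Ω) := by
  refine and_congr_right fun hu => and_congr_right fun _ => ?_
  rw [gagliardoE_eq_lintegral_weightedDiff hp hu,
    memLp_iff_lintegral_ofReal_abs_rpow_lt_top hp hu,
    memLp_iff_lintegral_ofReal_abs_rpow_lt_top hp (measurable_weightedDiff hu),
    memLp_iff_lintegral_ofReal_abs_rpow_lt_top (by linarith) hu]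

lemma MemX.add_mul (hp : 0 < p) (hq : 0 < q) {u ξ : Rn n → ℝ} (hu : MemX n Ω s p q u)
    (hξ : MemX n Ω s p q ξ) (t : ℝ) : MemX n Ω s p q fun x => u x + t * ξ x := by
  rw [memX_iff_memLp hp hq] at *
  obtain ⟨hum, hu0, hup, huD, huq⟩ := hu
  obtain ⟨hξm, hξ0, hξp, hξD, hξq⟩ := hξ
  refine ⟨by fun_prop, ?_, hup.add (hξp.const_mul t), ?_, huq.add (hξq.const_mul t)⟩
  · filter_upwards [hu0, hξ0] with x h1 h2 hx
    simp [h1 hx, h2 hx]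
  · rw [show weightedDiff n s p (fun x => u x + t * ξ x) = _ from
      funext (weightedDiff_add_mul u ξ t)]
    exact huD.add (hξD.const_mul t)

lemma MemX.midpoint (hp : 0 < p) (hq : 0 < q) {u w : Rn n → ℝ} (hu : MemX n Ω s p q u)
    (hw : MemX n Ω s p q w) : MemX n Ω s p q fun x => (u x + w x) / 2 := by
  have h := hu.add_mul hp hq (hw.add_mul hp hq hu (-1)) (1 / 2)
  convert h using 2
  ring

end WeightedDiff

/-! ### The energy whose minimizer solves the discrete equation -/

/-- The zeroth order energy density
`(|a| ^ (q + 1) / (q + 1) - |b| ^ (q - 1) b a + C |b| ^ (q + 1)) / h`; the last summand makes it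
nonnegative for `C` large. -/
def dataDensity (q h C b a : ℝ) : ℝ :=
  (|a| ^ (q + 1) / (q + 1) - |b| ^ (q - 1) * b * a + C * |b| ^ (q + 1)) / h

/-- The energy whose Euler-Lagrange equation is the discrete nonlocal equation. -/
def rotheEnergy (n : ℕ) (Ω : Set (Rn n)) (s p q h C : ℝ) (v u : Rn n → ℝ) : ℝ≥0∞ :=
  (∫⁻ z, ENNReal.ofReal (|weightedDiff n s p u z| ^ p / (2 * p))) +
    ∫⁻ x in Ω, ENNReal.ofReal (dataDensity q h C (v x) (u x))

lemma abs_abs_rpow_sub_one_mul_self {q : ℝ} (hq : q ≠ 0) (b : ℝ) :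
    |(|b| ^ (q - 1) * b)| = |b| ^ q := by
  have h := abs_abs_rpow_sub_mul_self (r := q + 1) (by simpa using hq) b
  rwa [show q + 1 - 2 = q - 1 by ring, add_sub_cancel_right] at h

section DataDensity

variable {q h C : ℝ}

lemma continuous_dataDensity (hq : 0 < q) (b : ℝ) : Continuous (dataDensity q h C b) := by
  have : Continuous fun a : ℝ => |a| ^ (q + 1) :=
    continuous_abs.rpow_const fun _ => Or.inr (by linarith)
  unfold dataDensity
  fun_prop

lemma abs_rpow_le_dataDensity (hq : 0 < q) (hh : 0 < h)
    (hC : ∀ a b : ℝ, |b| ^ q * |a| ≤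
      1 / (2 * (q + 1)) * |a| ^ (q + 1) + C * |b| ^ (q + 1)) (b a : ℝ) :
    |a| ^ (q + 1) ≤ 2 * (q + 1) * h * dataDensity q h C b a := by
  have h1 := hC a b
  rw [← abs_abs_rpow_sub_one_mul_self hq.ne', ← abs_mul] at h1
  have h2 := (le_abs_self _).trans h1
  have h3 : 2 * (q + 1) * h * dataDensity q h C b a = 2 * |a| ^ (q + 1) +
      2 * (q + 1) * (C * |b| ^ (q + 1) - |b| ^ (q - 1) * b * a) := by
    unfold dataDensity
    field_simp
    ring
  have h4 : 2 * (q + 1) * (|b| ^ (q - 1) * b * a - C * |b| ^ (q + 1)) ≤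
      2 * (q + 1) * (1 / (2 * (q + 1)) * |a| ^ (q + 1)) := by
    gcongr
    linarith
  have h5 : 2 * (q + 1) * (1 / (2 * (q + 1)) * |a| ^ (q + 1)) = |a| ^ (q + 1) := by
    field_simp
  rw [h3]
  linarith

lemma dataDensity_nonneg (hq : 0 < q) (hh : 0 < h)
    (hC : ∀ a b : ℝ, |b| ^ q * |a| ≤
      1 / (2 * (q + 1)) * |a| ^ (q + 1) + C * |b| ^ (q + 1)) (b a : ℝ) :
    0 ≤ dataDensity q h C b a := by
  have h1 := abs_rpow_le_dataDensity hq hh hC b a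
  have h2 : 0 ≤ |a| ^ (q + 1) := by positivity
  exact nonneg_of_mul_nonneg_right (h2.trans h1) (by positivity)

lemma dataDensity_midpoint_defect (hh : h ≠ 0) (hq : 0 < q) (b a₁ a₂ : ℝ) :
    dataDensity q h C b a₁ + dataDensity q h C b a₂ - 2 * dataDensity q h C b ((a₁ + a₂) / 2) =
      (|a₁| ^ (q + 1) + |a₂| ^ (q + 1) - 2 * |(a₁ + a₂) / 2| ^ (q + 1)) / ((q + 1) * h) := by
  unfold dataDensity
  field_simp
  ring

lemma dataDensity_midpoint_defect_nonneg (hh : 0 < h) (hq : 0 < q) (b a₁ a₂ : ℝ) :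
    0 ≤ dataDensity q h C b a₁ + dataDensity q h C b a₂ -
      2 * dataDensity q h C b ((a₁ + a₂) / 2) := by
  rw [dataDensity_midpoint_defect hh.ne' hq]
  have := two_mul_abs_midpoint_rpow_le (r := q + 1) (by linarith) a₁ a₂
  exact div_nonneg (by linarith) (by positivity)

lemma exists_abs_sub_rpow_le_dataDensity (hq : 0 < q) (hh : 0 < h)
    (hC : ∀ a b : ℝ, |b| ^ q * |a| ≤
      1 / (2 * (q + 1)) * |a| ^ (q + 1) + C * |b| ^ (q + 1)) {ε : ℝ} (hε : 0 < ε) :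
    ∃ K : ℝ, 0 ≤ K ∧ ∀ b a₁ a₂ : ℝ, |a₁ - a₂| ^ (q + 1) ≤
      ε * (dataDensity q h C b a₁ + dataDensity q h C b a₂) +
        K * (dataDensity q h C b a₁ + dataDensity q h C b a₂ -
          2 * dataDensity q h C b ((a₁ + a₂) / 2)) := by
  obtain ⟨K, hK0, hK⟩ := exists_abs_sub_rpow_le (r := q + 1) (by linarith)
    (ε := ε / (2 * (q + 1) * h)) (by positivity)
  refine ⟨K * ((q + 1) * h), by positivity, fun b a₁ a₂ => (hK a₁ a₂).trans ?_⟩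
  rw [dataDensity_midpoint_defect hh.ne' hq]
  refine add_le_add ?_ (le_of_eq (by field_simp))
  rw [div_mul_eq_mul_div, div_le_iff₀ (by positivity), mul_assoc]
  gcongr
  linarith [abs_rpow_le_dataDensity hq hh hC b a₁, abs_rpow_le_dataDensity hq hh hC b a₂]

end DataDensity

lemma ENNReal.liminf_add_liminf_le (a b : ℕ → ℝ≥0∞) :
    liminf a atTop + liminf b atTop ≤ liminf (fun k => a k + b k) atTop := by
  simp only [liminf_eq_iSup_iInf_of_nat]
  have hmono : ∀ c : ℕ → ℝ≥0∞, Monotone fun k => ⨅ i ≥ k, c i := fun c i j hij =>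
    le_iInf₂ fun l hl => iInf₂_le l (hij.trans hl)
  rw [ENNReal.iSup_add_iSup_of_monotone (hmono a) (hmono b)]
  exact iSup_mono fun k => le_iInf₂ fun i hi => add_le_add (iInf₂_le i hi) (iInf₂_le i hi)

section Energy

variable {n : ℕ} {Ω : Set (Rn n)} {s p q h C : ℝ} {u v w : Rn n → ℝ}

lemma integrable_abs_rpow_sub_one_mul (hp : 0 < p) (hq : 0 < q) (hv : MemX n Ω s p q v)
    (hu : MemX n Ω s p q u) :
    Integrable (fun x => |v x| ^ (q - 1) * v x * u x) (volume.restrict Ω) := by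
  rw [memX_iff_memLp hp hq] at hv hu
  have h := (hasDerivAt_integral_abs_add_mul_rpow (r := q + 1) (by linarith) hv.1 hu.1
    hv.2.2.2.2 hu.2.2.2.2).1
  rwa [show q + 1 - 2 = q - 1 by ring] at h

lemma integrable_dataDensity (hp : 0 < p) (hq : 0 < q) (hv : MemX n Ω s p q v)
    (hu : MemX n Ω s p q u) :
    Integrable (fun x => dataDensity q h C (v x) (u x)) (volume.restrict Ω) := by
  have hI := integrable_abs_rpow_sub_one_mul hp hq hv hu
  rw [memX_iff_memLp hp hq] at hv hu
  exact (((((hu.2.2.2.2).integrable_abs_rpow (by linarith)).div_const _).sub hI).add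
    ((hv.2.2.2.2.integrable_abs_rpow (by linarith)).const_mul C)).div_const h

lemma integrable_abs_weightedDiff_rpow (hp : 0 < p) (hq : 0 < q) (hu : MemX n Ω s p q u) :
    Integrable (fun z => |weightedDiff n s p u z| ^ p / (2 * p)) := by
  rw [memX_iff_memLp hp hq] at hu
  exact (hu.2.2.2.1.integrable_abs_rpow hp).div_const _

lemma rotheEnergy_eq_ofReal (hp : 0 < p) (hq : 0 < q)
    (hF : ∀ b a : ℝ, 0 ≤ dataDensity q h C b a)
    (hv : MemX n Ω s p q v) (hu : MemX n Ω s p q u) :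
    rotheEnergy n Ω s p q h C v u =
      ENNReal.ofReal ((∫ z, |weightedDiff n s p u z| ^ p / (2 * p)) +
        ∫ x in Ω, dataDensity q h C (v x) (u x)) := by
  have h0 : ∀ z, 0 ≤ |weightedDiff n s p u z| ^ p / (2 * p) := fun z => by positivity
  rw [ENNReal.ofReal_add (integral_nonneg h0) (integral_nonneg fun x => hF _ _),
    ofReal_integral_eq_lintegral_ofReal (integrable_abs_weightedDiff_rpow hp hq hu)
      (Eventually.of_forall h0),
    ofReal_integral_eq_lintegral_ofReal (integrable_dataDensity hp hq hv hu)
      (Eventually.of_forall fun x => hF _ _)]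
  rfl

lemma measurable_dataDensity (hv : Measurable v) (hu : Measurable u) :
    Measurable fun x => dataDensity q h C (v x) (u x) := by
  unfold dataDensity
  fun_prop

lemma memX_of_rotheEnergy_lt_top (hn : 1 ≤ n) (hΩ : Bornology.IsBounded Ω) (hs : 0 < s)
    (hp : 0 < p) (hq : 0 < q) (hh : 0 < h)
    (hC : ∀ a b : ℝ, |b| ^ q * |a| ≤
      1 / (2 * (q + 1)) * |a| ^ (q + 1) + C * |b| ^ (q + 1))
    (hu : Measurable u) (hu0 : ∀ᵐ x : Rn n, x ∉ Ω → u x = 0)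
    (hE : rotheEnergy n Ω s p q h C v u < ⊤) : MemX n Ω s p q u := by
  obtain ⟨h1, h2⟩ := ENNReal.add_lt_top.1 hE
  have hG : gagliardoE n s p u < ⊤ := by
    have hpt : ∀ z, ENNReal.ofReal (|weightedDiff n s p u z| ^ p) =
        ENNReal.ofReal (2 * p) * ENNReal.ofReal (|weightedDiff n s p u z| ^ p / (2 * p)) := by
      intro z
      rw [← ENNReal.ofReal_mul (by positivity)]
      congr 1
      field_simp
    rw [gagliardoE_eq_lintegral_weightedDiff hp hu, lintegral_congr hpt,
      lintegral_const_mul' _ _ ENNReal.ofReal_ne_top]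
    exact ENNReal.mul_lt_top ENNReal.ofReal_lt_top h1
  refine ⟨hu, hu0, lintegral_abs_rpow_lt_top_of_gagliardoE_lt_top hn hs hp hΩ hu0 hG, hG, ?_⟩
  calc ∫⁻ x in Ω, ENNReal.ofReal (|u x| ^ (q + 1))
      ≤ ∫⁻ x in Ω, ENNReal.ofReal (2 * (q + 1) * h) *
          ENNReal.ofReal (dataDensity q h C (v x) (u x)) := by
        refine lintegral_mono fun x => ?_
        rw [← ENNReal.ofReal_mul (by positivity)]
        exact ENNReal.ofReal_le_ofReal (abs_rpow_le_dataDensity hq hh hC _ _)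
    _ = ENNReal.ofReal (2 * (q + 1) * h) *
          ∫⁻ x in Ω, ENNReal.ofReal (dataDensity q h C (v x) (u x)) :=
        lintegral_const_mul' _ _ ENNReal.ofReal_ne_top
    _ < ⊤ := ENNReal.mul_lt_top ENNReal.ofReal_lt_top h2

/-- Midpoint convexity of the energy, with the defect of the zeroth order term. -/
lemma two_mul_rotheEnergy_midpoint_add_le (hp : 1 < p) (hq : 0 < q) (hh : 0 < h)
    (hF : ∀ b a : ℝ, 0 ≤ dataDensity q h C b a)
    (hv : Measurable v) (hu : Measurable u) (hw : Measurable w) :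
    2 * rotheEnergy n Ω s p q h C v (fun x => (u x + w x) / 2) +
        ∫⁻ x in Ω, ENNReal.ofReal (dataDensity q h C (v x) (u x) + dataDensity q h C (v x) (w x) -
          2 * dataDensity q h C (v x) ((u x + w x) / 2)) ≤
      rotheEnergy n Ω s p q h C v u + rotheEnergy n Ω s p q h C v w := by
  have hp0 : 0 < p := by linarith
  have mFu := measurable_dataDensity (q := q) (h := h) (C := C) hv hu
  have mFm := measurable_dataDensity (q := q) (h := h) (C := C) hv
    (u := fun x => (u x + w x) / 2) (by fun_prop)
  have mDu := measurable_weightedDiff (s := s) (p := p) hu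
  have h2 : (2 : ℝ≥0∞) = ENNReal.ofReal 2 := by simp
  have hA : 2 * ∫⁻ z, ENNReal.ofReal
        (|weightedDiff n s p (fun x => (u x + w x) / 2) z| ^ p / (2 * p)) ≤
      (∫⁻ z, ENNReal.ofReal (|weightedDiff n s p u z| ^ p / (2 * p))) +
        ∫⁻ z, ENNReal.ofReal (|weightedDiff n s p w z| ^ p / (2 * p)) := by
    rw [← lintegral_const_mul' _ _ (by simp), ← lintegral_add_left (by fun_prop)]
    refine lintegral_mono fun z => ?_
    rw [h2, ← ENNReal.ofReal_mul (by norm_num),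
      ← ENNReal.ofReal_add (by positivity) (by positivity), weightedDiff_midpoint,
      ← mul_div_assoc, ← add_div]
    gcongr
    exact two_mul_abs_midpoint_rpow_le hp _ _
  have hB : 2 * (∫⁻ x in Ω, ENNReal.ofReal (dataDensity q h C (v x) ((u x + w x) / 2))) +
        ∫⁻ x in Ω, ENNReal.ofReal (dataDensity q h C (v x) (u x) + dataDensity q h C (v x) (w x) -
          2 * dataDensity q h C (v x) ((u x + w x) / 2)) =
      (∫⁻ x in Ω, ENNReal.ofReal (dataDensity q h C (v x) (u x))) +
        ∫⁻ x in Ω, ENNReal.ofReal (dataDensity q h C (v x) (w x)) := by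
    rw [← lintegral_const_mul' _ _ (by simp), ← lintegral_add_left (by fun_prop),
      ← lintegral_add_left (by fun_prop)]
    refine lintegral_congr fun x => ?_
    rw [h2, ← ENNReal.ofReal_mul (by norm_num), ← ENNReal.ofReal_add
      (mul_nonneg (by norm_num) (hF _ _)) (dataDensity_midpoint_defect_nonneg hh hq _ _ _),
      ← ENNReal.ofReal_add (hF _ _) (hF _ _)]
    congr 1
    ring
  unfold rotheEnergy
  rw [mul_add, add_assoc, hB]
  refine (add_le_add_left hA _).trans (le_of_eq ?_)
  ring

/-- Near-minimizers of the energy are close in `L^{q+1}(Ω)`. -/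
lemma exists_lintegral_abs_sub_rpow_lt (hp : 1 < p) (hq : 0 < q) (hh : 0 < h)
    (hC : ∀ a b : ℝ, |b| ^ q * |a| ≤
      1 / (2 * (q + 1)) * |a| ^ (q + 1) + C * |b| ^ (q + 1))
    (hv : Measurable v) {m : ℝ≥0∞} (hm : m ≠ ⊤)
    (hmin : ∀ u, MemX n Ω s p q u → m ≤ rotheEnergy n Ω s p q h C v u)
    {η : ℝ≥0∞} (hη : 0 < η) :
    ∃ δ : ℝ≥0∞, 0 < δ ∧ ∀ u w, MemX n Ω s p q u → MemX n Ω s p q w →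
      rotheEnergy n Ω s p q h C v u ≤ m + δ → rotheEnergy n Ω s p q h C v w ≤ m + δ →
      ∫⁻ x in Ω, ENNReal.ofReal (|u x - w x| ^ (q + 1)) < η := by
  have hp0 : 0 < p := by linarith
  have hF := dataDensity_nonneg hq hh hC
  have hη2 : η / 2 ≠ 0 := (ENNReal.half_pos hη.ne').ne'
  obtain ⟨ε, hε, hεlt⟩ := ENNReal.exists_nnreal_pos_mul_lt
    (a := (m + 1) + (m + 1)) (by finiteness) hη2
  obtain ⟨K, hK0, hK⟩ := exists_abs_sub_rpow_le_dataDensity hq hh hC (ε := (ε : ℝ)) (by positivity)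
  obtain ⟨d, hd, hdlt⟩ := ENNReal.exists_nnreal_pos_mul_lt
    (a := 2 * ENNReal.ofReal K) (by finiteness) hη2
  refine ⟨min 1 d, lt_min one_pos (by simpa using hd), fun u w hu hw huE hwE => ?_⟩
  set δ : ℝ≥0∞ := min 1 d
  have hδ1 : δ ≤ 1 := min_le_left _ _
  have mFu := measurable_dataDensity (q := q) (h := h) (C := C) hv hu.1
  have mFw := measurable_dataDensity (q := q) (h := h) (C := C) hv hw.1
  have hdefect : ∫⁻ x in Ω, ENNReal.ofReal (dataDensity q h C (v x) (u x) +
      dataDensity q h C (v x) (w x) - 2 * dataDensity q h C (v x) ((u x + w x) / 2)) ≤ 2 * δ := by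
    refine ENNReal.le_of_add_le_add_left (a := 2 * m) (by finiteness) ?_
    calc _ ≤ 2 * rotheEnergy n Ω s p q h C v (fun x => (u x + w x) / 2) + _ := by
          gcongr
          exact hmin _ (hu.midpoint hp0 hq hw)
      _ ≤ _ := two_mul_rotheEnergy_midpoint_add_le hp hq hh hF hv hu.1 hw.1
      _ ≤ (m + δ) + (m + δ) := add_le_add huE hwE
      _ = 2 * m + 2 * δ := by ring
  calc ∫⁻ x in Ω, ENNReal.ofReal (|u x - w x| ^ (q + 1))
      ≤ ∫⁻ x in Ω, (ε * (ENNReal.ofReal (dataDensity q h C (v x) (u x)) +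
            ENNReal.ofReal (dataDensity q h C (v x) (w x))) +
          ENNReal.ofReal K * ENNReal.ofReal (dataDensity q h C (v x) (u x) +
            dataDensity q h C (v x) (w x) -
              2 * dataDensity q h C (v x) ((u x + w x) / 2))) := by
        refine lintegral_mono fun x => ?_
        have hsum := add_nonneg (hF (v x) (u x)) (hF (v x) (w x))
        rw [← ENNReal.ofReal_coe_nnreal (p := ε), ← ENNReal.ofReal_add (hF _ _) (hF _ _),
          ← ENNReal.ofReal_mul (by positivity), ← ENNReal.ofReal_mul hK0, ← ENNReal.ofReal_add
          (by positivity) (mul_nonneg hK0 (dataDensity_midpoint_defect_nonneg hh hq _ _ _))]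
        exact ENNReal.ofReal_le_ofReal (hK _ _ _)
    _ = ε * ((∫⁻ x in Ω, ENNReal.ofReal (dataDensity q h C (v x) (u x))) +
            ∫⁻ x in Ω, ENNReal.ofReal (dataDensity q h C (v x) (w x))) +
          ENNReal.ofReal K * ∫⁻ x in Ω, ENNReal.ofReal (dataDensity q h C (v x) (u x) +
            dataDensity q h C (v x) (w x) -
              2 * dataDensity q h C (v x) ((u x + w x) / 2)) := by
        rw [lintegral_add_left (by fun_prop), lintegral_const_mul' _ _ (by finiteness),
          lintegral_const_mul' _ _ (by finiteness), lintegral_add_left (by fun_prop)]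
    _ ≤ ε * ((m + 1) + (m + 1)) + ENNReal.ofReal K * (2 * d) := by
        gcongr
        · exact le_add_self.trans (huE.trans (by gcongr))
        · exact le_add_self.trans (hwE.trans (by gcongr))
        · exact hdefect.trans (by gcongr; exact min_le_right _ _)
    _ < η / 2 + η / 2 := by
        refine ENNReal.add_lt_add hεlt (lt_of_eq_of_lt ?_ hdlt)
        ring
    _ = η := ENNReal.add_halves η

/-- Lower semicontinuity of the energy under almost everywhere convergence. -/
lemma rotheEnergy_le_liminf (hp : 0 < p) (hq : 0 < q) (hv : Measurable v)
    {f : ℕ → Rn n → ℝ} (hf : ∀ k, Measurable (f k))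
    (hlim : ∀ᵐ x, Tendsto (fun k => f k x) atTop (nhds (u x))) :
    rotheEnergy n Ω s p q h C v u ≤
      liminf (fun k => rotheEnergy n Ω s p q h C v (f k)) atTop := by
  have hrpow : Continuous fun a : ℝ => |a| ^ p / (2 * p) :=
    (continuous_abs.rpow_const fun _ => Or.inr hp.le).div_const _
  refine le_trans (add_le_add ?_ ?_) (ENNReal.liminf_add_liminf_le _ _)
  · refine le_trans (le_of_eq (lintegral_congr_ae ?_)) (lintegral_liminf_le fun k => ?_)
    · rw [Measure.volume_eq_prod]
      filter_upwards [Measure.quasiMeasurePreserving_fst.ae hlim,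
        Measure.quasiMeasurePreserving_snd.ae hlim] with z h1 h2
      refine (Tendsto.liminf_eq ?_).symm
      refine ENNReal.tendsto_ofReal ((hrpow.tendsto _).comp ?_)
      exact (h1.sub h2).div_const _
    · have := measurable_weightedDiff (s := s) (p := p) (hf k)
      fun_prop
  · refine le_trans (le_of_eq (lintegral_congr_ae ?_)) (lintegral_liminf_le fun k => ?_)
    · filter_upwards [ae_restrict_of_ae hlim] with x hx
      refine (Tendsto.liminf_eq ?_).symm
      exact ENNReal.tendsto_ofReal (((continuous_dataDensity hq (v x)).tendsto _).comp hx)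
    · have := measurable_dataDensity (q := q) (h := h) (C := C) hv (hf k)
      fun_prop

/-- The direct method: the energy attains its minimum over `X`. -/
lemma exists_rotheEnergy_minimizer (hn : 1 ≤ n) (hΩo : IsOpen Ω) (hΩ : Bornology.IsBounded Ω)
    (hs : 0 < s) (hp : 1 < p) (hq : 0 < q) (hh : 0 < h)
    (hC : ∀ a b : ℝ, |b| ^ q * |a| ≤
      1 / (2 * (q + 1)) * |a| ^ (q + 1) + C * |b| ^ (q + 1))
    (hv : MemX n Ω s p q v) :
    ∃ u, MemX n Ω s p q u ∧ ∀ w, MemX n Ω s p q w →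
      rotheEnergy n Ω s p q h C v u ≤ rotheEnergy n Ω s p q h C v w := by
  have hp0 : 0 < p := by linarith
  have hF := dataDensity_nonneg hq hh hC
  set m : ℝ≥0∞ := ⨅ (u) (_ : MemX n Ω s p q u), rotheEnergy n Ω s p q h C v u with hm
  have hmin : ∀ u, MemX n Ω s p q u → m ≤ rotheEnergy n Ω s p q h C v u :=
    fun u hu => iInf₂_le u hu
  have hmtop : m ≠ ⊤ := by
    refine ne_top_of_le_ne_top ?_ (hmin v hv)
    rw [rotheEnergy_eq_ofReal hp0 hq hF hv hv]
    exact ENNReal.ofReal_ne_top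
  have hseq : ∀ k : ℕ, ∃ u, MemX n Ω s p q u ∧
      rotheEnergy n Ω s p q h C v u ≤ m + (k : ℝ≥0∞)⁻¹ := by
    intro k
    have hlt : m < m + (k : ℝ≥0∞)⁻¹ := ENNReal.lt_add_right hmtop (by simp)
    obtain ⟨u, hu⟩ := iInf_lt_iff.1 (hm ▸ hlt)
    obtain ⟨huX, hu⟩ := iInf_lt_iff.1 hu
    exact ⟨u, huX, hu.le⟩
  choose f hfX hfE using hseq
  obtain ⟨φ, hφ, hφlim⟩ := exists_subseq_ae_tendsto_of_cauchy (μ := volume.restrict Ω)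
    (r := q + 1) (by linarith) (fun k => (hfX k).1) (by
      intro η hη
      obtain ⟨δ, hδ, hclose⟩ := exists_lintegral_abs_sub_rpow_lt hp hq hh hC hv.1 hmtop hmin hη
      obtain ⟨N, hN⟩ := ENNReal.exists_inv_nat_lt hδ.ne'
      have hle : ∀ i ≥ N, rotheEnergy n Ω s p q h C v (f i) ≤ m + δ := fun i hi =>
        (hfE i).trans (add_le_add_right
          ((ENNReal.inv_le_inv.2 (Nat.cast_le.2 hi)).trans hN.le) _)
      exact ⟨N, fun i hi j hj => hclose _ _ (hfX i) (hfX j) (hle i hi) (hle j hj)⟩)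
  rw [ae_restrict_iff' hΩo.measurableSet] at hφlim
  have hzero : ∀ᵐ x : Rn n, ∀ k, x ∉ Ω → f (φ k) x = 0 := ae_all_iff.2 fun k => (hfX (φ k)).2.1
  obtain ⟨u, hum, hu⟩ := measurable_limit_of_tendsto_metrizable_ae (μ := (volume : Measure (Rn n)))
    (f := fun k => f (φ k)) (L := atTop) (fun k => (hfX (φ k)).1.aemeasurable) (by
      filter_upwards [hφlim, hzero] with x h1 h2
      by_cases hx : x ∈ Ω
      · exact h1 hx
      · exact ⟨0, by simp [h2 _ hx]⟩)
  have hu0 : ∀ᵐ x : Rn n, x ∉ Ω → u x = 0 := by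
    filter_upwards [hu, hzero] with x h1 h2 hx
    refine tendsto_nhds_unique h1 ?_
    simp [h2 _ hx]
  have huE : rotheEnergy n Ω s p q h C v u ≤ m := by
    refine (rotheEnergy_le_liminf hp0 hq hv.1 (fun k => (hfX (φ k)).1) hu).trans ?_
    refine (liminf_le_liminf (Eventually.of_forall fun k => hfE (φ k))).trans (le_of_eq ?_)
    refine Tendsto.liminf_eq ?_
    simpa using (tendsto_const_nhds (x := m)).add
      (ENNReal.tendsto_inv_nat_nhds_zero.comp hφ.tendsto_atTop)
  exact ⟨u, memX_of_rotheEnergy_lt_top hn hΩ hs hp0 hq hh hC hum hu0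
    (huE.trans_lt hmtop.lt_top), fun w hw => huE.trans (hmin w hw)⟩

/-- Minimizers of the energy solve the discrete equation. -/
lemma solvesDiscrete_of_minimizer (hp : 1 < p) (hq : 0 < q) (hh : 0 < h)
    (hF : ∀ b a : ℝ, 0 ≤ dataDensity q h C b a)
    (hv : MemX n Ω s p q v) (hu : MemX n Ω s p q u)
    (hmin : ∀ w, MemX n Ω s p q w →
      rotheEnergy n Ω s p q h C v u ≤ rotheEnergy n Ω s p q h C v w) :
    SolvesDiscrete n Ω s p q h u v := by
  intro ξ hξ
  have hp0 : 0 < p := by linarith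
  have hIv := integrable_abs_rpow_sub_one_mul hp0 hq hv hξ
  have hIvu := integrable_abs_rpow_sub_one_mul hp0 hq hv hu
  have hX := fun t => hu.add_mul hp0 hq hξ t
  have hu' := (memX_iff_memLp hp0 hq).1 hu
  have hξ' := (memX_iff_memLp hp0 hq).1 hξ
  have hv' := (memX_iff_memLp hp0 hq).1 hv
  obtain ⟨hIG, hDG⟩ := hasDerivAt_integral_abs_add_mul_rpow hp
    (measurable_weightedDiff (s := s) (p := p) hu.1)
    (measurable_weightedDiff (s := s) (p := p) hξ.1) hu'.2.2.2.1 hξ'.2.2.2.1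
  obtain ⟨hIu, hDu⟩ := hasDerivAt_integral_abs_add_mul_rpow (r := q + 1) (by linarith)
    hu.1 hξ.1 hu'.2.2.2.2 hξ'.2.2.2.2
  rw [show q + 1 - 2 = q - 1 by ring] at hIu hDu
  set J : ℝ → ℝ := fun t =>
    (∫ z, |weightedDiff n s p (fun x => u x + t * ξ x) z| ^ p / (2 * p)) +
      ∫ x in Ω, dataDensity q h C (v x) (u x + t * ξ x) with hJ
  have hJmin : IsLocalMin J 0 := Eventually.of_forall fun t => by
    have h1 := hmin _ (hX t)
    rw [rotheEnergy_eq_ofReal hp0 hq hF hv hu, rotheEnergy_eq_ofReal hp0 hq hF hv (hX t),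
      ENNReal.ofReal_le_ofReal_iff (add_nonneg (integral_nonneg fun z => by positivity)
        (integral_nonneg fun x => hF _ _))] at h1
    simpa [hJ] using h1
  have hJeq : J = fun t =>
      (∫ z, |weightedDiff n s p u z + t * weightedDiff n s p ξ z| ^ p) / (2 * p) +
        ((∫ x in Ω, |u x + t * ξ x| ^ (q + 1)) / (q + 1) -
          ((∫ x in Ω, |v x| ^ (q - 1) * v x * u x) +
            t * ∫ x in Ω, |v x| ^ (q - 1) * v x * ξ x) +
          C * ∫ x in Ω, |v x| ^ (q + 1)) / h := by
    funext t
    have hIt := integrable_abs_rpow_sub_one_mul hp0 hq hv (hX t)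
    have ht := ((memX_iff_memLp hp0 hq).1 (hX t)).2.2.2.2.integrable_abs_rpow
      (by linarith : 0 < q + 1)
    have hvq := hv'.2.2.2.2.integrable_abs_rpow (by linarith : 0 < q + 1)
    have hsub : Integrable (fun x => |u x + t * ξ x| ^ (q + 1) / (q + 1) -
        |v x| ^ (q - 1) * v x * (u x + t * ξ x)) (volume.restrict Ω) := (ht.div_const _).sub hIt
    have hlin : (∫ x in Ω, |v x| ^ (q - 1) * v x * (u x + t * ξ x)) =
        (∫ x in Ω, |v x| ^ (q - 1) * v x * u x) +
          t * ∫ x in Ω, |v x| ^ (q - 1) * v x * ξ x := by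
      rw [← integral_const_mul, ← integral_add hIvu (hIv.const_mul t)]
      refine integral_congr_ae (Eventually.of_forall fun x => ?_)
      ring
    simp only [hJ, weightedDiff_add_mul, integral_div, dataDensity]
    rw [integral_add hsub (hvq.const_mul C), integral_sub (ht.div_const _) hIt, integral_div,
      integral_const_mul, hlin]
  have hJ' : HasDerivAt J
      (p * (∫ z, |weightedDiff n s p u z| ^ (p - 2) * weightedDiff n s p u z *
          weightedDiff n s p ξ z) / (2 * p) +
        ((q + 1) * (∫ x in Ω, |u x| ^ (q - 1) * u x * ξ x) / (q + 1) -
          ∫ x in Ω, |v x| ^ (q - 1) * v x * ξ x) / h) 0 := by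
    rw [hJeq]
    have hlin : HasDerivAt (fun t : ℝ => (∫ x in Ω, |v x| ^ (q - 1) * v x * u x) +
        t * ∫ x in Ω, |v x| ^ (q - 1) * v x * ξ x)
        (∫ x in Ω, |v x| ^ (q - 1) * v x * ξ x) 0 := by
      simpa using ((hasDerivAt_id (0 : ℝ)).mul_const
        (∫ x in Ω, |v x| ^ (q - 1) * v x * ξ x)).const_add
          (∫ x in Ω, |v x| ^ (q - 1) * v x * u x)
    exact (hDG.div_const _).add ((((hDu.div_const _).sub hlin).add_const _).div_const _)
  have h0 := hJmin.hasDerivAt_eq_zero hJ'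
  have hdouble : (∫ z, |weightedDiff n s p u z| ^ (p - 2) * weightedDiff n s p u z *
      weightedDiff n s p ξ z) = ∫ x : Rn n, ∫ y : Rn n,
        (|u x - u y| ^ (p - 2) * (u x - u y)) * (ξ x - ξ y) /
          dist x y ^ ((n : ℝ) + s * p) := by
    rw [Measure.volume_eq_prod] at hIG ⊢
    rw [integral_prod _ hIG]
    simp only [abs_weightedDiff_rpow_mul hp0]
  have hsingle : (∫ x in Ω, (|u x| ^ (q - 1) * u x - |v x| ^ (q - 1) * v x) * ξ x) =
      (∫ x in Ω, |u x| ^ (q - 1) * u x * ξ x) - ∫ x in Ω, |v x| ^ (q - 1) * v x * ξ x := by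
    simp only [sub_mul]
    exact integral_sub hIu hIv
  rw [← hdouble, hsingle, ← h0]
  field_simp
  ring

end Energy

/-- Lemma 3.1: existence of a solution of the nonlocal difference equation. -/
theorem existence_discrete_equation
    (n : ℕ) (hn : 1 ≤ n) (Ω : Set (Rn n)) (hΩ : IsBoundedDomain Ω)
    (s p q : ℝ) (hs : s ∈ Ioo (0 : ℝ) 1) (hp : 1 < p) (hq : 0 < q)
    (h : ℝ) (hh : 0 < h) (v : Rn n → ℝ) (hv : MemX n Ω s p q v) :
    ∃ u : Rn n → ℝ, MemX n Ω s p q u ∧ SolvesDiscrete n Ω s p q h u v := by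
  obtain ⟨C, hC⟩ := exists_abs_rpow_mul_abs_le hq (ε := 1 / (2 * (q + 1))) (by positivity)
  obtain ⟨u, hu, hmin⟩ :=
    exists_rotheEnergy_minimizer hn hΩ.1 hΩ.2.2 hs.1 hp hq hh hC hv
  exact ⟨u, hu, solvesDiscrete_of_minimizer hp hq hh (dataDensity_nonneg hq hh hC) hv hu hmin⟩
end
end

section
/- Uniform boundedness of the difference scheme (Lemma B.1). Let n ≥ 1, let Ω ⊂ ℝⁿ be a bounded domain, s ∈ (0,1), p > 1, q > 0, h > 0, N ∈ ℕ, and let u₀, u₁, …, u_N ∈ X satisfy the scheme hypothesis (for each m = 1,…,N, u_m solves the discrete equation with datum u_{m−1} and step h). If M ≥ 0 and |u₀| ≤ M a.e. in Ω, then |u_m| ≤ M a.e. in Ω for every m = 1,…,N; in particular ess sup_Ω |u_m| ≤ ess sup_Ω |u₀| for all m. -/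
open MeasureTheory ENNReal Real Filter Set

noncomputable section

/-- The odd power `t ↦ |t|^(q-1) t` is strictly increasing. -/
lemma strictMono_abs_rpow_mul {q : ℝ} (hq : 0 < q) :
    StrictMono fun t : ℝ => |t| ^ (q - 1) * t := by
  have key : ∀ t : ℝ, 0 ≤ t → |t| ^ (q - 1) * t = t ^ q := by
    intro t ht
    rcases ht.eq_or_lt with rfl | ht
    · simp [Real.zero_rpow hq.ne']
    · rw [abs_of_pos ht, ← Real.rpow_add_one ht.ne', sub_add_cancel]
  intro a b hab
  change |a| ^ (q - 1) * a < |b| ^ (q - 1) * b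
  rcases le_or_gt 0 a with ha | ha
  · rw [key a ha, key b (ha.trans hab.le)]
    exact Real.rpow_lt_rpow ha hab hq
  · have ha' : |a| ^ (q - 1) * a < 0 :=
      mul_neg_of_pos_of_neg (Real.rpow_pos_of_pos (abs_pos.2 ha.ne) _) ha
    rcases le_or_gt 0 b with hb | hb
    · exact ha'.trans_le (mul_nonneg (Real.rpow_nonneg (abs_nonneg _) _) hb)
    · have h1 := key (-a) (by linarith)
      have h2 := key (-b) (by linarith)
      rw [abs_neg] at h1 h2
      have h3 : (-b) ^ q < (-a) ^ q := Real.rpow_lt_rpow (by linarith) (by linarith) hq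
      linarith

lemma abs_abs_rpow_mul {q : ℝ} (hq : 0 < q) (t : ℝ) :
    |(|t| ^ (q - 1) * t)| = |t| ^ q := by
  rw [abs_mul, abs_of_nonneg (Real.rpow_nonneg (abs_nonneg _) _)]
  rcases (abs_nonneg t).eq_or_lt with ht | ht
  · rw [← ht]; simp [Real.zero_rpow hq.ne']
  · rw [← Real.rpow_add_one ht.ne', sub_add_cancel]

/-- Young-type bound for the product of a `q`-th power and a first power. -/
lemma rpow_mul_le_rpow_add_rpow {q a b : ℝ} (hq : 0 < q) (ha : 0 ≤ a) (hb : 0 ≤ b) :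
    a ^ q * b ≤ a ^ (q + 1) + b ^ (q + 1) := by
  have hsucc : ∀ t : ℝ, 0 ≤ t → t ^ (q + 1) = t ^ q * t := fun t ht => by
    rw [Real.rpow_add_of_nonneg ht hq.le zero_le_one, Real.rpow_one]
  rcases le_total a b with hab | hab
  · calc a ^ q * b ≤ b ^ q * b := by gcongr
      _ = b ^ (q + 1) := (hsucc b hb).symm
      _ ≤ _ := le_add_of_nonneg_left (Real.rpow_nonneg ha _)
  · calc a ^ q * b ≤ a ^ q * a := by gcongr
      _ = a ^ (q + 1) := (hsucc a ha).symm
      _ ≤ _ := le_add_of_nonneg_right (Real.rpow_nonneg hb _)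

/-- The class `X` is stable under composition with `1`-Lipschitz maps fixing the origin. -/
lemma MemX.comp_of_abs_sub_le {n : ℕ} {Ω : Set (Rn n)} {s p q : ℝ} {u : Rn n → ℝ}
    (hp : 0 < p) (hq : 0 < q) (hu : MemX n Ω s p q u) {f : ℝ → ℝ} (hfm : Measurable f)
    (hf : ∀ a b, |f a - f b| ≤ |a - b|) (hf0 : f 0 = 0) :
    MemX n Ω s p q fun x => f (u x) := by
  obtain ⟨hm, hz, hLp, hG, hLq⟩ := hu
  have hle : ∀ a, |f a| ≤ |a| := fun a => by simpa [hf0] using hf a 0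
  refine ⟨hfm.comp hm, ?_, lt_of_le_of_lt (lintegral_mono fun x => ?_) hLp,
    lt_of_le_of_lt (lintegral_mono fun x => lintegral_mono fun y => ?_) hG,
    lt_of_le_of_lt (lintegral_mono fun x => ?_) hLq⟩
  · filter_upwards [hz] with x hx hxΩ
    rw [hx hxΩ, hf0]
  · exact ENNReal.ofReal_le_ofReal (Real.rpow_le_rpow (abs_nonneg _) (hle _) hp.le)
  · apply ENNReal.ofReal_le_ofReal
    exact div_le_div_of_nonneg_right (Real.rpow_le_rpow (abs_nonneg _) (hf _ _) hp.le)
      (Real.rpow_nonneg dist_nonneg _)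
  · exact ENNReal.ofReal_le_ofReal (Real.rpow_le_rpow (abs_nonneg _) (hle _) (by linarith))

lemma MemX.neg {n : ℕ} {Ω : Set (Rn n)} {s p q : ℝ} {u : Rn n → ℝ}
    (hp : 0 < p) (hq : 0 < q) (hu : MemX n Ω s p q u) :
    MemX n Ω s p q fun x => -u x :=
  hu.comp_of_abs_sub_le hp hq measurable_neg (fun a b => by rw [← abs_neg]; ring_nf; rfl) neg_zero

lemma MemX.integrableOn_rpow {n : ℕ} {Ω : Set (Rn n)} {s p q : ℝ} {u : Rn n → ℝ}
    (hu : MemX n Ω s p q u) :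
    Integrable (fun x => |u x| ^ (q + 1)) (volume.restrict Ω) := by
  obtain ⟨hm, -, -, -, hLq⟩ := hu
  refine ⟨(hm.abs.pow_const _).aestronglyMeasurable, ?_⟩
  rwa [hasFiniteIntegral_iff_ofReal (ae_of_all _ fun x => Real.rpow_nonneg (abs_nonneg _) _)]

lemma MemX.integrableOn_abs_rpow_mul_mul {n : ℕ} {Ω : Set (Rn n)} {s p q : ℝ}
    {u ξ : Rn n → ℝ} (hq : 0 < q) (hu : MemX n Ω s p q u) (hξ : MemX n Ω s p q ξ) :
    Integrable (fun x => |u x| ^ (q - 1) * u x * ξ x) (volume.restrict Ω) := by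
  refine (hu.integrableOn_rpow.add hξ.integrableOn_rpow).mono'
    (((hu.1.abs.pow_const _).mul hu.1).mul hξ.1).aestronglyMeasurable (ae_of_all _ fun x => ?_)
  rw [Real.norm_eq_abs, abs_mul, abs_abs_rpow_mul hq]
  exact rpow_mul_le_rpow_add_rpow hq (abs_nonneg _) (abs_nonneg _)

lemma SolvesDiscrete.neg {n : ℕ} {Ω : Set (Rn n)} {s p q h : ℝ} {u v : Rn n → ℝ}
    (huv : SolvesDiscrete n Ω s p q h u v) :
    SolvesDiscrete n Ω s p q h (fun x => -u x) fun x => -v x := by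
  intro ξ hξ
  have H := huv ξ hξ
  have h1 : ∀ x, (|-u x| ^ (q - 1) * -u x - |-v x| ^ (q - 1) * -v x) * ξ x =
      -((|u x| ^ (q - 1) * u x - |v x| ^ (q - 1) * v x) * ξ x) := fun x => by
    rw [abs_neg, abs_neg]; ring
  have h2 : ∀ x y, (|-u x - -u y| ^ (p - 2) * (-u x - -u y)) * (ξ x - ξ y) /
      dist x y ^ ((n : ℝ) + s * p) =
      -((|u x - u y| ^ (p - 2) * (u x - u y)) * (ξ x - ξ y) /
        dist x y ^ ((n : ℝ) + s * p)) := fun x y => by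
    rw [show -u x - -u y = -(u x - u y) by ring, abs_neg]; ring
  simp only [h1, h2, integral_neg]
  linarith

/-- One step of the scheme preserves upper bounds by nonnegative constants. -/
lemma SolvesDiscrete.ae_le {n : ℕ} {Ω : Set (Rn n)} {s p q h M : ℝ} {u v : Rn n → ℝ}
    (hp : 0 < p) (hq : 0 < q) (hh : 0 < h) (hu : MemX n Ω s p q u) (hv : MemX n Ω s p q v)
    (huv : SolvesDiscrete n Ω s p q h u v) (hM : 0 ≤ M)
    (hvM : ∀ᵐ x ∂(volume.restrict Ω), v x ≤ M) :
    ∀ᵐ x ∂(volume.restrict Ω), u x ≤ M := by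
  have hmono : Monotone fun t : ℝ => max (t - M) 0 := fun a b hab =>
    max_le_max (by linarith) le_rfl
  have hξ : MemX n Ω s p q fun x => max (u x - M) 0 := by
    refine hu.comp_of_abs_sub_le (f := fun t => max (t - M) 0) hp hq (by fun_prop)
      (fun a b => ?_) (by simpa using hM)
    simpa using abs_max_sub_max_le_abs (a - M) (b - M) 0
  have hφ := strictMono_abs_rpow_mul hq
  have hE : 0 ≤ ∫ x : Rn n, ∫ y : Rn n, (|u x - u y| ^ (p - 2) * (u x - u y)) *
      (max (u x - M) 0 - max (u y - M) 0) / dist x y ^ ((n : ℝ) + s * p) := by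
    refine integral_nonneg fun x => integral_nonneg fun y => ?_
    refine div_nonneg ?_ (Real.rpow_nonneg dist_nonneg _)
    rw [mul_assoc]
    refine mul_nonneg (Real.rpow_nonneg (abs_nonneg _) _) ?_
    rcases le_total (u x) (u y) with hxy | hxy
    · exact mul_nonneg_of_nonpos_of_nonpos (sub_nonpos.2 hxy) (sub_nonpos.2 (hmono hxy))
    · exact mul_nonneg (sub_nonneg.2 hxy) (sub_nonneg.2 (hmono hxy))
  have hpos : 0 ≤ᵐ[volume.restrict Ω] fun x =>
      (|u x| ^ (q - 1) * u x - |v x| ^ (q - 1) * v x) * max (u x - M) 0 := by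
    filter_upwards [hvM] with x hx
    rcases le_total (u x) M with hxM | hxM
    · simp [max_eq_right (sub_nonpos.2 hxM)]
    · exact mul_nonneg (sub_nonneg.2 (hφ.monotone (hx.trans hxM))) (le_max_right _ _)
  have hint : Integrable (fun x =>
      (|u x| ^ (q - 1) * u x - |v x| ^ (q - 1) * v x) * max (u x - M) 0)
      (volume.restrict Ω) := by
    simp only [sub_mul]
    exact (hu.integrableOn_abs_rpow_mul_mul hq hξ).sub (hv.integrableOn_abs_rpow_mul_mul hq hξ)
  have hzero : ∫ x in Ω, (|u x| ^ (q - 1) * u x - |v x| ^ (q - 1) * v x) * max (u x - M) 0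
      = 0 := by
    refine le_antisymm ?_ (integral_nonneg_of_ae hpos)
    have H := huv _ hξ
    refine nonpos_of_mul_nonpos_right ?_ (one_div_pos.2 hh)
    linarith
  filter_upwards [(integral_eq_zero_iff_of_nonneg_ae hpos hint).1 hzero, hvM] with x hx hxM
  by_contra! hlt
  refine (mul_pos (sub_pos.2 (hφ (hxM.trans_lt hlt))) ?_).ne' hx
  exact lt_max_of_lt_left (sub_pos.2 hlt)

/-- One step of the scheme preserves bounds on the absolute value. -/
lemma SolvesDiscrete.ae_abs_le {n : ℕ} {Ω : Set (Rn n)} {s p q h M : ℝ} {u v : Rn n → ℝ}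
    (hp : 0 < p) (hq : 0 < q) (hh : 0 < h) (hu : MemX n Ω s p q u) (hv : MemX n Ω s p q v)
    (huv : SolvesDiscrete n Ω s p q h u v) (hM : 0 ≤ M)
    (hvM : ∀ᵐ x ∂(volume.restrict Ω), |v x| ≤ M) :
    ∀ᵐ x ∂(volume.restrict Ω), |u x| ≤ M := by
  filter_upwards [huv.ae_le hp hq hh hu hv hM (hvM.mono fun x hx => (abs_le'.1 hx).1),
    huv.neg.ae_le hp hq hh (hu.neg hp hq) (hv.neg hp hq) hM
      (hvM.mono fun x hx => (abs_le'.1 hx).2)] with x h1 h2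
  exact abs_le'.2 ⟨h1, h2⟩

/-- Lemma B.1: uniform boundedness of the difference scheme. -/
theorem scheme_uniform_boundedness
    (n : ℕ) (hn : 1 ≤ n) (Ω : Set (Rn n)) (hΩ : IsBoundedDomain Ω)
    (s p q : ℝ) (hs : s ∈ Ioo (0 : ℝ) 1) (hp : 1 < p) (hq : 0 < q)
    (h : ℝ) (hh : 0 < h) (N : ℕ) (u : ℕ → Rn n → ℝ)
    (hX : ∀ m, m ≤ N → MemX n Ω s p q (u m))
    (hscheme : ∀ m, 1 ≤ m → m ≤ N → SolvesDiscrete n Ω s p q h (u m) (u (m - 1))) :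
    (∀ M : ℝ, 0 ≤ M → (∀ᵐ x ∂(volume.restrict Ω), |u 0 x| ≤ M) →
      ∀ m, 1 ≤ m → m ≤ N → ∀ᵐ x ∂(volume.restrict Ω), |u m x| ≤ M) ∧
    (∀ m, m ≤ N →
      essSup (fun x => ENNReal.ofReal |u m x|) (volume.restrict Ω)
        ≤ essSup (fun x => ENNReal.ofReal |u 0 x|) (volume.restrict Ω)) := by
  have hbound : ∀ M : ℝ, 0 ≤ M → (∀ᵐ x ∂(volume.restrict Ω), |u 0 x| ≤ M) →
      ∀ m, m ≤ N → ∀ᵐ x ∂(volume.restrict Ω), |u m x| ≤ M := by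
    intro M hM h0 m
    induction m with
    | zero => exact fun _ => h0
    | succ m ih =>
      intro hm
      exact (hscheme (m + 1) (by omega) hm).ae_abs_le (by linarith) hq hh (hX _ hm)
        (hX m (by omega)) hM (ih (by omega))
  refine ⟨fun M hM h0 m _ hm => hbound M hM h0 m hm, fun m hm => ?_⟩
  by_cases htop : essSup (fun x => ENNReal.ofReal |u 0 x|) (volume.restrict Ω) = ⊤
  · rw [htop]
    exact le_top
  refine essSup_le_of_ae_le _ ?_
  have h0 : ∀ᵐ x ∂(volume.restrict Ω), |u 0 x| ≤
      (essSup (fun x => ENNReal.ofReal |u 0 x|) (volume.restrict Ω)).toReal := by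
    filter_upwards [ENNReal.ae_le_essSup (μ := volume.restrict Ω)
      fun x => ENNReal.ofReal |u 0 x|] with x hx
    exact (ENNReal.ofReal_le_iff_le_toReal htop).1 hx
  filter_upwards [hbound _ ENNReal.toReal_nonneg h0 m hm] with x hx
  exact (ENNReal.ofReal_le_iff_le_toReal htop).2 hx
end
end
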